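/- Let N ≥ 1, let λ_1 < λ_2 < … < λ_N be real numbers and let u_1, …, u_N ∈ (-1,1)\{0} satisfy Σ_{i=1}^N u_i² = 1. Define s_{λ,u}(l) = Σ_{i=1}^N u_i²/(l − λ_i) for l > λ_N. (i) If 1 > |α| ≥ |u_N|, then sup_{σ ∈ ℝ^N, |σ|=1, σ·u = α} Σ_{i=1}^N λ_i σ_i² = inf_{l > λ_N} { l − α²/s_{λ,u}(l) }. (ii) If α ∈ [-|u_N|, |u_N|], then λ_N − (2 u_N²/√(1-u_N²))(λ_N − λ_1) ≤ sup_{σ ∈ ℝ^N, |σ|=1, σ·u = α} Σ_{i=1}^N λ_i σ_i² ≤ λ_N. -/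

import Mathlib

open Matrix

lemma aux_upper (N : ℕ) (lam : Fin (N + 1) → ℝ) (hlam : StrictMono lam)
    (σ : Fin (N + 1) → ℝ) (h1 : ∑ i, σ i ^ 2 = 1) :
    ∑ i, lam i * σ i ^ 2 ≤ lam (Fin.last N) := by
  calc ∑ i, lam i * σ i ^ 2 ≤ ∑ i, lam (Fin.last N) * σ i ^ 2 :=
        Finset.sum_le_sum fun i _ =>
          mul_le_mul_of_nonneg_right (hlam.monotone (Fin.le_last i)) (sq_nonneg _)
    _ = lam (Fin.last N) := by rw [← Finset.mul_sum, h1, mul_one]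

lemma aux_weak (N : ℕ) (lam : Fin (N + 1) → ℝ) (hlam : StrictMono lam)
    (u : Fin (N + 1) → ℝ) (hu : ∀ i, u i ≠ 0)
    (σ : Fin (N + 1) → ℝ) (h1 : ∑ i, σ i ^ 2 = 1) (α l : ℝ) (h2 : σ ⬝ᵥ u = α)
    (hl : lam (Fin.last N) < l) :
    ∑ i, lam i * σ i ^ 2 ≤ l - α ^ 2 / ∑ i, u i ^ 2 / (l - lam i) := by
  have hp : ∀ i, 0 < l - lam i := fun i => by
    have := hlam.monotone (Fin.le_last i)
    linarith
  have hs : 0 < ∑ i, u i ^ 2 / (l - lam i) :=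
    Finset.sum_pos (fun i _ => div_pos (by have := hu i; positivity) (hp i))
      Finset.univ_nonempty
  have hcs : α ^ 2 ≤ (∑ i, (l - lam i) * σ i ^ 2) * ∑ i, u i ^ 2 / (l - lam i) := by
    rw [← h2]
    apply Finset.sum_sq_le_sum_mul_sum_of_sq_eq_mul
    · exact fun i _ => mul_nonneg (hp i).le (sq_nonneg _)
    · exact fun i _ => div_nonneg (sq_nonneg _) (hp i).le
    · intro i _
      have := (hp i).ne'
      field_simp
  have he : ∑ i, (l - lam i) * σ i ^ 2 = l - ∑ i, lam i * σ i ^ 2 := by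
    simp only [sub_mul, Finset.sum_sub_distrib, ← Finset.mul_sum, h1, mul_one]
  rw [he] at hcs
  have := (div_le_iff₀ hs).2 hcs
  linarith

lemma aux_exists (N : ℕ) (lam : Fin (N + 1) → ℝ) (hlam : StrictMono lam)
    (u : Fin (N + 1) → ℝ) (hu : ∀ i, u i ≠ 0) (hu2 : ∑ i, u i ^ 2 = 1) (α : ℝ)
    (h1 : u (Fin.last N) ^ 2 < α ^ 2) (h2 : α ^ 2 < 1) :
    ∃ l, lam (Fin.last N) < l ∧
      (∑ i, u i ^ 2 / (l - lam i)) ^ 2 = α ^ 2 * ∑ i, u i ^ 2 / (l - lam i) ^ 2 := by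
  set L := lam (Fin.last N) with hL
  have hp : ∀ l, L < l → ∀ i, 0 < l - lam i := fun l hl i => by
    have := hlam.monotone (Fin.le_last i)
    linarith
  let w : Fin (N + 1) → ℝ → ℝ := fun i l => (l - L) / (l - lam i)
  let H : ℝ → ℝ := fun l => (∑ i, u i ^ 2 * w i l) ^ 2 - α ^ 2 * ∑ i, u i ^ 2 * (w i l) ^ 2
  have hw0 : ∀ i, Filter.Tendsto (w i) (nhdsWithin L (Set.Ioi L))
      (nhds (if i = Fin.last N then 1 else 0)) := by
    intro i
    by_cases hi : i = Fin.last N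
    · rw [if_pos hi]
      refine tendsto_const_nhds.congr' ?_
      filter_upwards [self_mem_nhdsWithin] with l hl
      have : l - L ≠ 0 := (sub_pos.2 hl).ne'
      simp only [w, hi, ← hL]
      rw [div_self this]
    · rw [if_neg hi]
      have hlt : lam i < L := hlam (Fin.lt_last_iff_ne_last.2 hi)
      have hc : ContinuousAt (w i) L := by
        apply ContinuousAt.div (by fun_prop) (by fun_prop)
        exact (sub_pos.2 hlt).ne'
      have := hc.tendsto.mono_left (nhdsWithin_le_nhds (s := Set.Ioi L))
      simpa [w] using this
  have hw1 : ∀ i, Filter.Tendsto (w i) Filter.atTop (nhds 1) := by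
    intro i
    have h : Filter.Tendsto (fun l : ℝ => 1 - (L - lam i) / (l - lam i)) Filter.atTop
        (nhds (1 - 0)) := by
      apply Filter.Tendsto.sub tendsto_const_nhds
      apply Filter.Tendsto.div_atTop tendsto_const_nhds
      exact Filter.tendsto_atTop_add_const_right _ (-lam i) Filter.tendsto_id
    rw [sub_zero] at h
    refine h.congr' ?_
    filter_upwards [Filter.eventually_gt_atTop L] with l hl
    have := (hp l hl i).ne'
    simp only [w]
    field_simp
    ring
  have hlim : ∀ (F : Filter ℝ) (c : Fin (N + 1) → ℝ),
      (∀ i, Filter.Tendsto (w i) F (nhds (c i))) →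
      Filter.Tendsto H F (nhds ((∑ i, u i ^ 2 * c i) ^ 2 - α ^ 2 * ∑ i, u i ^ 2 * (c i) ^ 2)) := by
    intro F c hc
    apply Filter.Tendsto.sub
    · exact (tendsto_finsetSum _ fun i _ => (hc i).const_mul _).pow 2
    · exact (tendsto_finsetSum _ fun i _ => ((hc i).pow 2).const_mul _).const_mul _
  have hH0 := hlim _ _ hw0
  have hH1 := hlim _ _ hw1
  simp only [ite_pow, one_pow, mul_ite, mul_one, mul_zero, ne_eq, OfNat.ofNat_ne_zero,
    not_false_eq_true, zero_pow, Finset.sum_ite_eq', Finset.mem_univ, if_true, hu2] at hH0 hH1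
  have hun : 0 < u (Fin.last N) ^ 2 := by have := hu (Fin.last N); positivity
  obtain ⟨l1, hl1, hl1'⟩ := ((hH0.eventually (gt_mem_nhds
    (show _ < (0:ℝ) by nlinarith))).and self_mem_nhdsWithin).exists
  obtain ⟨l2, hl2, hl2'⟩ := ((hH1.eventually (lt_mem_nhds
    (show (0:ℝ) < _ by nlinarith))).and (Filter.eventually_gt_atTop L)).exists
  have hcont : ContinuousOn H (Set.Ioi L) := by
    have hwc : ∀ i, ContinuousOn (w i) (Set.Ioi L) := fun i =>
      ContinuousOn.div (by fun_prop) (by fun_prop) fun l hl => (hp l hl i).ne'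
    apply ContinuousOn.sub
    · exact (continuousOn_finset_sum _ fun i _ => (continuousOn_const.mul (hwc i))).pow 2
    · exact continuousOn_const.mul
        (continuousOn_finset_sum _ fun i _ => (continuousOn_const.mul ((hwc i).pow 2)))
  obtain ⟨l, hl, hHl⟩ := isPreconnected_Ioi.intermediate_value hl1' hl2' hcont
    (Set.mem_Icc.2 ⟨hl1.le, hl2.le⟩)
  refine ⟨l, hl, ?_⟩
  have ht : (l - L) ^ 2 ≠ 0 := pow_ne_zero _ (sub_pos.2 hl).ne'
  have e1 : ∑ i, u i ^ 2 * w i l = (l - L) * ∑ i, u i ^ 2 / (l - lam i) := by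
    rw [Finset.mul_sum]
    exact Finset.sum_congr rfl fun i _ => by simp only [w]; ring
  have e2 : ∑ i, u i ^ 2 * (w i l) ^ 2 = (l - L) ^ 2 * ∑ i, u i ^ 2 / (l - lam i) ^ 2 := by
    rw [Finset.mul_sum]
    exact Finset.sum_congr rfl fun i _ => by simp only [w, div_pow]; ring
  have : (l - L) ^ 2 * ((∑ i, u i ^ 2 / (l - lam i)) ^ 2) =
      (l - L) ^ 2 * (α ^ 2 * ∑ i, u i ^ 2 / (l - lam i) ^ 2) := by
    simp only [H] at hHl
    rw [e1, e2] at hHl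
    linear_combination hHl
  exact mul_left_cancel₀ ht this

lemma aux_point (N : ℕ) (lam : Fin (N + 1) → ℝ) (hlam : StrictMono lam)
    (u : Fin (N + 1) → ℝ) (hu : ∀ i, u i ≠ 0) (hu2 : ∑ i, u i ^ 2 = 1)
    (hlt : u (Fin.last N) ^ 2 < 1) (α : ℝ)
    (hα : |α| ≤ |u (Fin.last N)|) :
    ∃ σ : Fin (N + 1) → ℝ, ∑ i, σ i ^ 2 = 1 ∧ σ ⬝ᵥ u = α ∧
      lam (Fin.last N) - u (Fin.last N) ^ 2 * (lam (Fin.last N) - lam 0)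
        ≤ ∑ i, lam i * σ i ^ 2 := by
  set a := u (Fin.last N) with ha
  have hα2 : α ^ 2 ≤ a ^ 2 := sq_le_sq.2 hα
  have hb : 0 < Real.sqrt (1 - a ^ 2) := Real.sqrt_pos.2 (by linarith)
  have hb2 : Real.sqrt (1 - a ^ 2) ^ 2 = 1 - a ^ 2 := Real.sq_sqrt (by linarith)
  set b := Real.sqrt (1 - a ^ 2)
  have hr : 0 ≤ Real.sqrt (1 - α ^ 2) := Real.sqrt_nonneg _
  have hr2 : Real.sqrt (1 - α ^ 2) ^ 2 = 1 - α ^ 2 := Real.sq_sqrt (by linarith)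
  set r := Real.sqrt (1 - α ^ 2)
  obtain ⟨s, hs, hsa⟩ : ∃ s : ℝ, s ^ 2 = 1 ∧ s * (α * a) = |α| * |a| := by
    rw [← abs_mul]
    rcases le_total 0 (α * a) with h | h
    · exact ⟨1, by norm_num, by rw [abs_of_nonneg h]; ring⟩
    · exact ⟨-1, by norm_num, by rw [abs_of_nonpos h]; ring⟩
  have hk : |α| * b ≤ |a| * r := by
    apply le_of_sq_le_sq _ (by positivity)
    rw [mul_pow, mul_pow, sq_abs, sq_abs, hb2, hr2]
    nlinarith
  set c := α * a + s * b * r with hc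
  set d := α * b - s * a * r with hd
  have hcd : c ^ 2 + d ^ 2 = 1 := by
    have : c ^ 2 + d ^ 2 = (α ^ 2 + s ^ 2 * r ^ 2) * (a ^ 2 + b ^ 2) := by rw [hc, hd]; ring
    rw [this, hs, hr2, hb2]; ring
  have hcu : c * a + d * b = α := by
    have : c * a + d * b = α * (a ^ 2 + b ^ 2) := by rw [hc, hd]; ring
    rw [this, hb2]; ring
  have hd2 : d ^ 2 ≤ a ^ 2 := by
    have e : d ^ 2 = α ^ 2 * b ^ 2 - 2 * (|α| * b) * (|a| * r) + a ^ 2 * r ^ 2 := by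
      have : d ^ 2 = α ^ 2 * b ^ 2 - 2 * (s * (α * a)) * b * r + s ^ 2 * a ^ 2 * r ^ 2 := by
        rw [hd]; ring
      rw [this, hs, hsa]; ring
    have h3 : (|α| * b) * (|α| * b) ≤ (|α| * b) * (|a| * r) :=
      mul_le_mul_of_nonneg_left hk (by positivity)
    have h4 : (|α| * b) * (|α| * b) = α ^ 2 * b ^ 2 := by
      rw [← sq_abs α]; ring
    have h5 : 0 ≤ α ^ 2 * b ^ 2 := by positivity
    have h6 : a ^ 2 * r ^ 2 = a ^ 2 - a ^ 2 * α ^ 2 := by rw [hr2]; ring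
    have h7 : 0 ≤ a ^ 2 * α ^ 2 := by positivity
    linarith
  have hS : ∑ i : Fin N, u i.castSucc ^ 2 = b ^ 2 := by
    rw [Fin.sum_univ_castSucc] at hu2
    rw [hb2]; linarith
  let σ : Fin (N + 1) → ℝ := Fin.snoc (α := fun _ => ℝ) (fun i : Fin N => d / b * u i.castSucc) c
  have hσl : σ (Fin.last N) = c := by simp [σ]
  have hσc : ∀ i : Fin N, σ i.castSucc = d / b * u i.castSucc := fun i => by simp [σ]
  have hS2 : ∑ i : Fin N, (d / b * u i.castSucc) ^ 2 = d ^ 2 := by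
    simp only [mul_pow, ← Finset.mul_sum, hS]
    field_simp
  refine ⟨σ, ?_, ?_, ?_⟩
  · rw [Fin.sum_univ_castSucc]
    simp only [hσl, hσc, hS2]
    linarith
  · simp only [dotProduct]
    rw [Fin.sum_univ_castSucc]
    simp only [hσl, hσc, mul_assoc, ← pow_two, ← Finset.mul_sum, hS]
    rw [← hcu, ← ha]
    field_simp
    ring
  · rw [Fin.sum_univ_castSucc]
    simp only [hσl, hσc]
    have : lam 0 * d ^ 2 ≤ ∑ i : Fin N, lam i.castSucc * (d / b * u i.castSucc) ^ 2 := by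
      rw [← hS2, Finset.mul_sum]
      exact Finset.sum_le_sum fun i _ =>
        mul_le_mul_of_nonneg_right (hlam.monotone (Fin.zero_le _)) (sq_nonneg _)
    have h0 : lam 0 ≤ lam (Fin.last N) := hlam.monotone (Fin.zero_le _)
    have h8 : d ^ 2 * (lam (Fin.last N) - lam 0) ≤ a ^ 2 * (lam (Fin.last N) - lam 0) :=
      mul_le_mul_of_nonneg_right hd2 (by linarith)
    have h9 : c ^ 2 = 1 - d ^ 2 := by linarith
    rw [h9]
    linarith

/-- Lemma: reduction of the constrained optimization via Lagrange multipliers.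
Here the dimension is `N + 1 ≥ 1`, `λ_N = lam (Fin.last N)` and `λ_1 = lam 0`. -/
theorem stmt_4 (N : ℕ) (lam : Fin (N + 1) → ℝ) (hlam : StrictMono lam)
    (u : Fin (N + 1) → ℝ) (hu1 : ∀ i, u i ∈ Set.Ioo (-1 : ℝ) 1 ∧ u i ≠ 0)
    (hu2 : ∑ i, u i ^ 2 = 1) (α : ℝ)
    (Q : ℝ)
    (hQ : Q = sSup {y : ℝ | ∃ σ : Fin (N + 1) → ℝ, ∑ i, σ i ^ 2 = 1 ∧ σ ⬝ᵥ u = α ∧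
        y = ∑ i, lam i * σ i ^ 2}) :
    ((|u (Fin.last N)| ≤ |α| ∧ |α| < 1) →
      Q = sInf {y : ℝ | ∃ l : ℝ, lam (Fin.last N) < l ∧
        y = l - α ^ 2 / ∑ i, u i ^ 2 / (l - lam i)}) ∧
    (|α| ≤ |u (Fin.last N)| →
      lam (Fin.last N) -
          2 * u (Fin.last N) ^ 2 / Real.sqrt (1 - u (Fin.last N) ^ 2) *
            (lam (Fin.last N) - lam 0) ≤ Q ∧
        Q ≤ lam (Fin.last N)) := by
  have hu : ∀ i, u i ≠ 0 := fun i => (hu1 i).2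
  have hlt : u (Fin.last N) ^ 2 < 1 := by
    have := (hu1 (Fin.last N)).1
    rw [sq_lt_one_iff_abs_lt_one]
    exact abs_lt.2 ⟨this.1, this.2⟩
  have hun : 0 < u (Fin.last N) ^ 2 := by have := hu (Fin.last N); positivity
  constructor
  · rintro ⟨h1, h2⟩
    have hα1 : α ^ 2 < 1 := (sq_lt_one_iff_abs_lt_one α).2 h2
    rcases (sq_le_sq.2 h1).lt_or_eq with h | h
    · obtain ⟨l, hl, he⟩ := aux_exists N lam hlam u hu hu2 α h hα1
      have hp : ∀ i, 0 < l - lam i := fun i => by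
        have := hlam.monotone (Fin.le_last i)
        linarith
      have hs : 0 < ∑ i, u i ^ 2 / (l - lam i) :=
        Finset.sum_pos (fun i _ => div_pos (by have := hu i; positivity) (hp i))
          Finset.univ_nonempty
      set s := ∑ i, u i ^ 2 / (l - lam i) with hsd
      have hmul : ∀ k : ℝ, k * s = ∑ i, k * (u i ^ 2 / (l - lam i)) :=
        fun k => Finset.mul_sum _ _ _
      let σ : Fin (N + 1) → ℝ := fun i => α / s * (u i / (l - lam i))
      have hσ1 : ∑ i, σ i ^ 2 = 1 := by
        simp only [σ, mul_pow, ← Finset.mul_sum, div_pow] at he ⊢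
        rw [div_mul_eq_mul_div, ← he]
        exact div_self (by positivity)
      have hσ2 : σ ⬝ᵥ u = α := by
        have : σ ⬝ᵥ u = α / s * s := by
          simp only [dotProduct]
          rw [hmul]
          exact Finset.sum_congr rfl fun i _ => by simp only [σ]; ring
        rw [this]; field_simp
      have hσ3 : ∑ i, lam i * σ i ^ 2 = l - α ^ 2 / s := by
        have e1 : ∑ i, (l - lam i) * σ i ^ 2 = (α / s) ^ 2 * s := by
          rw [hmul]
          refine Finset.sum_congr rfl fun i _ => ?_
          have := (hp i).ne'
          simp only [σ]
          field_simp
        have e2 : ∑ i, (l - lam i) * σ i ^ 2 = l - ∑ i, lam i * σ i ^ 2 := by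
          simp only [sub_mul, Finset.sum_sub_distrib, ← Finset.mul_sum, hσ1, mul_one]
        have e3 : (α / s) ^ 2 * s = α ^ 2 / s := by field_simp
        linarith
      have hG : IsGreatest {y : ℝ | ∃ σ : Fin (N + 1) → ℝ, ∑ i, σ i ^ 2 = 1 ∧ σ ⬝ᵥ u = α ∧
          y = ∑ i, lam i * σ i ^ 2} (l - α ^ 2 / s) := by
        refine ⟨⟨σ, hσ1, hσ2, hσ3.symm⟩, ?_⟩
        rintro y ⟨τ, t1, t2, rfl⟩
        exact aux_weak N lam hlam u hu τ t1 α l t2 hl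
      have hLst : IsLeast {y : ℝ | ∃ l : ℝ, lam (Fin.last N) < l ∧
          y = l - α ^ 2 / ∑ i, u i ^ 2 / (l - lam i)} (l - α ^ 2 / s) := by
        refine ⟨⟨l, hl, rfl⟩, ?_⟩
        rintro y ⟨l', hl', rfl⟩
        rw [← hσ3]
        exact aux_weak N lam hlam u hu σ hσ1 α l' hσ2 hl'
      rw [hQ, hG.csSup_eq, hLst.csInf_eq]
    · have hs : ∃ s : ℝ, s ^ 2 = 1 ∧ s * u (Fin.last N) = α := by
        rcases sq_eq_sq_iff_eq_or_eq_neg.1 h with h | h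
        · exact ⟨1, by norm_num, by rw [h]; ring⟩
        · exact ⟨-1, by norm_num, by rw [h]; ring⟩
      obtain ⟨s, hs1, hs2⟩ := hs
      have hσ1 : ∑ i, (Pi.single (Fin.last N) s : Fin (N + 1) → ℝ) i ^ 2 = 1 := by
        simp [Pi.single_apply, ite_pow, hs1]
      have hσ2 : (Pi.single (Fin.last N) s : Fin (N + 1) → ℝ) ⬝ᵥ u = α := by
        simp [hs2]
      have hσ3 : lam (Fin.last N) =
          ∑ i, lam i * (Pi.single (Fin.last N) s : Fin (N + 1) → ℝ) i ^ 2 := by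
        simp [Pi.single_apply, ite_pow, hs1]
      have hG : IsGreatest {y : ℝ | ∃ σ : Fin (N + 1) → ℝ, ∑ i, σ i ^ 2 = 1 ∧ σ ⬝ᵥ u = α ∧
          y = ∑ i, lam i * σ i ^ 2} (lam (Fin.last N)) := by
        refine ⟨⟨_, hσ1, hσ2, hσ3⟩, ?_⟩
        rintro y ⟨τ, t1, t2, rfl⟩
        exact aux_upper N lam hlam τ t1
      have hI : IsGLB {y : ℝ | ∃ l : ℝ, lam (Fin.last N) < l ∧
          y = l - α ^ 2 / ∑ i, u i ^ 2 / (l - lam i)} (lam (Fin.last N)) := by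
        constructor
        · rintro y ⟨l', hl', rfl⟩
          rw [hσ3]
          exact aux_weak N lam hlam u hu _ hσ1 α l' hσ2 hl'
        · intro x hx
          refine le_of_forall_gt_imp_ge_of_dense fun l hl => ?_
          refine (hx ⟨l, hl, rfl⟩).trans ?_
          have : 0 ≤ α ^ 2 / ∑ i, u i ^ 2 / (l - lam i) := by
            refine div_nonneg (sq_nonneg _) (Finset.sum_nonneg fun i _ =>
              div_nonneg (sq_nonneg _) ?_)
            have := hlam.monotone (Fin.le_last i)
            linarith
          linarith
      rw [hQ, hG.csSup_eq, hI.csInf_eq]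
      exact ⟨_, lam (Fin.last N) + 1, by linarith, rfl⟩
  · intro hα
    obtain ⟨σ, h1, h2, h3⟩ := aux_point N lam hlam u hu hu2 hlt α hα
    have hub : lam (Fin.last N) ∈ upperBounds {y : ℝ | ∃ σ : Fin (N + 1) → ℝ,
        ∑ i, σ i ^ 2 = 1 ∧ σ ⬝ᵥ u = α ∧ y = ∑ i, lam i * σ i ^ 2} := by
      rintro y ⟨τ, t1, t2, rfl⟩
      exact aux_upper N lam hlam τ t1
    rw [hQ]
    refine ⟨?_, csSup_le ⟨_, σ, h1, h2, rfl⟩ hub⟩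
    refine le_trans ?_ (le_csSup ⟨_, hub⟩ ⟨σ, h1, h2, rfl⟩)
    refine le_trans ?_ h3
    have h0 : lam 0 ≤ lam (Fin.last N) := hlam.monotone (Fin.zero_le _)
    have hb : 0 < Real.sqrt (1 - u (Fin.last N) ^ 2) := Real.sqrt_pos.2 (by linarith)
    have hb1 : Real.sqrt (1 - u (Fin.last N) ^ 2) ≤ 1 := Real.sqrt_le_one.2 (by linarith)
    have : u (Fin.last N) ^ 2 ≤ 2 * u (Fin.last N) ^ 2 / Real.sqrt (1 - u (Fin.last N) ^ 2) := by
      rw [le_div_iff₀ hb]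
      nlinarith
    have := mul_le_mul_of_nonneg_right this (sub_nonneg.2 h0)
    linarith
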